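/- arXiv:1409.5957 — 5 statements merged into one kernel-verified Lean document; each statement's English description precedes it below -/
import Mathlib

section
/- Let N ≥ 1, let ι be a finite index type (the edge elements of a puzzle), let M be a finite type (the edge types), let τ : ι → M assign each edge its type, let s : ι → ℤ take only the values 1 and -1 (each edge is either a positive or a negative edge of its type), let piece : ι → Fin N, B : ι → ℂ and T : Fin N → ℂ. Assume that for every m : M the number of edges e with τ e = m and s e = 1 equals the number of edges e with τ e = m and s e = -1; call this common number K m. Then the following are equivalent: (i) for every m : M and every natural number k with 1 ≤ k ≤ K m, ∑_{e : τ e = m, s e = 1} (T (piece e) · B e)^k = ∑_{e : τ e = m, s e = -1} (T (piece e) · B e)^k; (ii) for every m : M, the multiset {T (piece e) · B e : τ e = m, s e = 1} equals the multiset {T (piece e) · B e : τ e = m, s e = -1}. (The core of Proposition 2 of the paper: the polynomial system with K(c,θ) equations per edge type is a complete representation of the puzzle.) -/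
/-- Newton's identities for the elements of a multiset. -/
theorem Multiset.mul_esymm_eq_sum {R : Type*} [CommRing R] (s : Multiset R) (k : ℕ) :
    (k : R) * s.esymm k = (-1) ^ (k + 1) *
      ∑ a ∈ Finset.HasAntidiagonal.antidiagonal k with a.1 < k,
        (-1) ^ a.1 * s.esymm a.1 * (s.map (· ^ a.2)).sum := by
  classical
  have hesymm (j : ℕ) : MvPolynomial.aeval (fun x : s => (x : R)) (MvPolynomial.esymm s R j) =
      s.esymm j := by
    rw [MvPolynomial.aeval_esymm_eq_multiset_esymm, Multiset.map_univ_coe]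
  have hpsum (j : ℕ) : MvPolynomial.aeval (fun x : s => (x : R)) (MvPolynomial.psum s R j) =
      (s.map (· ^ j)).sum := by
    rw [MvPolynomial.psum, map_sum, ← Multiset.map_univ s (· ^ j)]
    simp only [map_pow, MvPolynomial.aeval_X, Finset.sum_eq_multiset_sum]
  simpa only [map_mul, map_natCast, map_pow, map_neg, map_one, map_sum, hesymm, hpsum] using
    congrArg (MvPolynomial.aeval (fun x : s => (x : R))) (MvPolynomial.mul_esymm_eq_sum s R k)

/-- The elementary symmetric functions of degree at most `n` are determined by the power sums
of degrees `1` to `n`. -/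
theorem Multiset.esymm_eq_of_sum_pow_eq {R : Type*} [CommRing R] [IsDomain R] [CharZero R]
    {s t : Multiset R} {n : ℕ}
    (h : ∀ k, 1 ≤ k → k ≤ n → (s.map (· ^ k)).sum = (t.map (· ^ k)).sum) :
    ∀ k ≤ n, s.esymm k = t.esymm k := by
  intro k
  induction k using Nat.strong_induction_on with
  | _ k ih =>
    intro hk
    rcases Nat.eq_zero_or_pos k with rfl | hpos
    · simp [Multiset.esymm]
    · apply mul_left_cancel₀ (Nat.cast_ne_zero.mpr hpos.ne' : (k : R) ≠ 0)
      rw [Multiset.mul_esymm_eq_sum, Multiset.mul_esymm_eq_sum]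
      congr 1
      refine Finset.sum_congr rfl fun a ha => ?_
      obtain ⟨hsum, hlt⟩ := Finset.mem_filter.mp ha
      rw [Finset.HasAntidiagonal.mem_antidiagonal] at hsum
      rw [ih a.1 hlt (by omega), h a.2 (by omega) (by omega)]

/-- Two multisets of the same size `n` whose power sums of degrees `1` to `n` agree are equal. -/
theorem Multiset.eq_of_sum_pow_eq {R : Type*} [CommRing R] [IsDomain R] [CharZero R]
    {s t : Multiset R} (hcard : s.card = t.card)
    (h : ∀ k, 1 ≤ k → k ≤ s.card → (s.map (· ^ k)).sum = (t.map (· ^ k)).sum) : s = t := by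
  rw [← Polynomial.roots_multiset_prod_X_sub_C s, ← Polynomial.roots_multiset_prod_X_sub_C t,
    Multiset.prod_X_sub_X_eq_sum_esymm, Multiset.prod_X_sub_X_eq_sum_esymm, ← hcard]
  congr 1
  refine Finset.sum_congr rfl fun j hj => ?_
  rw [Multiset.esymm_eq_of_sum_pow_eq h j (Nat.lt_succ_iff.mp (Finset.mem_range.mp hj))]

/-- Core of Proposition 2 (completeness of the polynomial representation):
with `K m` equations of the form (8) for each edge type `m` — where `K m` is the
number of positive (equivalently, negative) edges of type `m` — the polynomial
system holds iff the placement pairs the edges of every type. -/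
theorem puzzle_complete_polynomial_representation
    (N : ℕ) (hN : 1 ≤ N) (ι : Type*) [Fintype ι]
    (M : Type*) [Fintype M] [DecidableEq M]
    (τ : ι → M) (s : ι → ℤ) (hs : ∀ e, s e = 1 ∨ s e = -1)
    (piece : ι → Fin N) (B : ι → ℂ) (T : Fin N → ℂ)
    (K : M → ℕ)
    (hKpos : ∀ m : M,
      (Finset.univ.filter (fun e => τ e = m ∧ s e = 1)).card = K m)
    (hKneg : ∀ m : M,
      (Finset.univ.filter (fun e => τ e = m ∧ s e = -1)).card = K m) :
    (∀ m : M, ∀ k : ℕ, 1 ≤ k → k ≤ K m →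
        ∑ e ∈ Finset.univ.filter (fun e => τ e = m ∧ s e = 1),
            (T (piece e) * B e) ^ k =
          ∑ e ∈ Finset.univ.filter (fun e => τ e = m ∧ s e = -1),
            (T (piece e) * B e) ^ k) ↔
      (∀ m : M,
        (Finset.univ.filter (fun e => τ e = m ∧ s e = 1)).val.map
            (fun e => T (piece e) * B e) =
          (Finset.univ.filter (fun e => τ e = m ∧ s e = -1)).val.map
            (fun e => T (piece e) * B e)) := by
  refine forall_congr' fun m => ⟨fun h => ?_, fun h k _ _ => ?_⟩
  · apply Multiset.eq_of_sum_pow_eq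
    · simp only [Multiset.card_map, Finset.card_val, hKpos, hKneg]
    · intro k hk hkK
      rw [Multiset.card_map, Finset.card_val, hKpos] at hkK
      simpa only [Finset.sum_eq_multiset_sum, Multiset.map_map, Function.comp_def] using h k hk hkK
  · simpa only [Finset.sum_eq_multiset_sum, Multiset.map_map, Function.comp_def] using congrArg (fun u => (u.map (· ^ k)).sum) h
end

section
/- Fix N ≥ 1, v : Fin N → ℂ, and a natural number K with K ≥ N. Then for every u : Fin N → ℂ, the following are equivalent: (i) for every natural number k with 1 ≤ k ≤ K, ∑_{i} (u i)^k = ∑_{i} (v i)^k; (ii) there exists a permutation σ of Fin N such that u i = v (σ i) for all i. (Lemma B.2 of the paper: the solutions of the bipartite polynomial system are exactly the permutations of v.) -/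
open Finset in
/-- By Newton's identities, over a domain of characteristic zero the first `K` power sums of a
finite family determine its first `K` elementary symmetric functions. -/
theorem aeval_esymm_eq_of_sum_pow_eq {ι R : Type*} [Fintype ι] [CommRing R] [IsDomain R]
    [CharZero R] {u v : ι → R} {K : ℕ}
    (h : ∀ k, 1 ≤ k → k ≤ K → ∑ i, u i ^ k = ∑ i, v i ^ k) (k : ℕ) (hk : k ≤ K) :
    MvPolynomial.aeval u (MvPolynomial.esymm ι R k) =
      MvPolynomial.aeval v (MvPolynomial.esymm ι R k) := by
  induction k using Nat.strong_induction_on with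
  | _ k ih =>
    rcases Nat.eq_zero_or_pos k with rfl | hpos
    · simp
    have newton (w : ι → R) :=
      congrArg (MvPolynomial.aeval w) (MvPolynomial.mul_esymm_eq_sum ι R k)
    simp only [map_mul, map_sum, map_pow, map_neg, map_one, map_natCast] at newton
    refine mul_left_cancel₀ (Nat.cast_ne_zero.mpr hpos.ne' : (k : R) ≠ 0) ?_
    rw [newton u, newton v]
    congr 1
    refine sum_congr rfl fun a ha => ?_
    obtain ⟨hsum, hlt⟩ := mem_filter.mp ha
    rw [HasAntidiagonal.mem_antidiagonal] at hsum
    rw [ih a.1 hlt (by lia)]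
    congr 1
    simpa [MvPolynomial.psum] using h a.2 (by lia) (by lia)

/-- Two families with the same multiset of values differ by a permutation of the indices. -/
theorem exists_perm_of_map_univ_eq {ι α : Type*} [Fintype ι] {u v : ι → α}
    (h : Finset.univ.val.map u = Finset.univ.val.map v) :
    ∃ σ : Equiv.Perm ι, ∀ i, u i = v (σ i) := by
  classical
  have hcard (c : α) : Fintype.card {i // u i = c} = Fintype.card {i // v i = c} := by
    have hc := congrArg (Multiset.count c) h
    simp only [Multiset.count_map] at hc
    simpa [Fintype.card_subtype, Finset.card_def, Finset.filter_val, eq_comm] using hc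
  exact ⟨Equiv.ofFiberEquiv fun c => Fintype.equivOfCardEq (hcard c),
    fun i => (Equiv.ofFiberEquiv_map _ i).symm⟩

/-- Over a domain of characteristic zero, a finite family is determined as a multiset by as many
power sums as it has members. -/
theorem map_univ_eq_of_sum_pow_eq {ι R : Type*} [Fintype ι] [CommRing R] [IsDomain R]
    [CharZero R] {u v : ι → R}
    (h : ∀ k, 1 ≤ k → k ≤ Fintype.card ι → ∑ i, u i ^ k = ∑ i, v i ^ k) :
    Finset.univ.val.map u = Finset.univ.val.map v := by
  have hesymm (k : ℕ) (hk : k ≤ Fintype.card ι) :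
      (Finset.univ.val.map u).esymm k = (Finset.univ.val.map v).esymm k := by
    simpa only [MvPolynomial.aeval_esymm_eq_multiset_esymm] using
      aeval_esymm_eq_of_sum_pow_eq h k hk
  rw [← Polynomial.roots_multiset_prod_X_sub_C (Finset.univ.val.map u),
    ← Polynomial.roots_multiset_prod_X_sub_C (Finset.univ.val.map v),
    Multiset.prod_X_sub_X_eq_sum_esymm, Multiset.prod_X_sub_X_eq_sum_esymm]
  simp only [Multiset.card_map]
  congr 1
  refine Finset.sum_congr rfl fun j hj => ?_
  rw [hesymm j (Nat.lt_succ_iff.mp (Finset.mem_range.mp hj))]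

/-- Lemma B.2: for `K ≥ N`, the solutions `u` of the bipartite power-sum system
`∑ i (u i)^k = ∑ i (v i)^k`, `k = 1, …, K`, are exactly the permutations of `v`. -/
theorem bipartite_system_solutions_are_permutations
    (N : ℕ) (hN : 1 ≤ N) (v : Fin N → ℂ) (K : ℕ) (hK : N ≤ K) :
    ∀ u : Fin N → ℂ,
      (∀ k : ℕ, 1 ≤ k → k ≤ K →
          ∑ i : Fin N, (u i) ^ k = ∑ i : Fin N, (v i) ^ k) ↔
        ∃ σ : Equiv.Perm (Fin N), ∀ i, u i = v (σ i) := by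
  intro u
  constructor
  · intro h
    refine exists_perm_of_map_univ_eq (map_univ_eq_of_sum_pow_eq fun k hk hkN => ?_)
    exact h k hk ((Fintype.card_fin N ▸ hkN).trans hK)
  · rintro ⟨σ, hσ⟩ k - -
    simp only [hσ]
    exact Equiv.sum_comp σ fun i => v i ^ k
end

section
/- Let K ≥ 1 and let z : ℕ → ℝ with z 0 = 1. Let Z be the (K+1) × (K+1) real Hankel matrix with entries Z i j = z (i + j) for i, j ∈ Fin (K+1). Then the following are equivalent: (i) Z has rank 1 and z n ≥ 0 for all n ≤ 2K; (ii) z 1 ≥ 0 and z n = (z 1)^n for all n ≤ 2K. (The lemma of Section 5.2.2 of the paper characterizing rank-one nonnegative Hankel matrices.) -/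
/-- All 2 × 2 minors of a matrix of rank at most one vanish. -/
theorem Matrix.mul_apply_comm_of_rank_le_one {m n F : Type*} [Fintype m] [Fintype n] [Field F]
    {A : Matrix m n F} (h : A.rank ≤ 1) (i k : m) (j l : n) :
    A i j * A k l = A i l * A k j := by
  classical
  rw [Matrix.rank, finrank_le_one_iff] at h
  obtain ⟨v, hv⟩ := h
  have hcol (j : n) : ∃ c : F, ∀ i, A i j = c * v.1 i := by
    obtain ⟨c, hc⟩ := hv ⟨A.mulVecLin (Pi.single j 1), LinearMap.mem_range_self _ _⟩
    refine ⟨c, fun i => ?_⟩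
    have := congrFun (congrArg Subtype.val hc) i
    simpa using this.symm
  obtain ⟨c, hc⟩ := hcol j
  obtain ⟨d, hd⟩ := hcol l
  rw [hc, hc, hd, hd]
  ring

/-- An outer product of two nonzero vectors has rank one. -/
theorem Matrix.rank_vecMulVec_eq_one {m n F : Type*} [Fintype m] [Fintype n] [Field F]
    {u : m → F} {v : n → F} {i : m} {j : n} (hu : u i ≠ 0) (hv : v j ≠ 0) :
    (Matrix.vecMulVec u v).rank = 1 := by
  classical
  refine le_antisymm (Matrix.rank_vecMulVec_le u v) (Nat.one_le_iff_ne_zero.2 fun h => ?_)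
  rw [Matrix.rank, Submodule.finrank_eq_zero, LinearMap.range_eq_bot] at h
  have := congrFun (LinearMap.congr_fun h (Pi.single j 1)) i
  simp [Matrix.vecMulVec_apply, hu, hv] at this


/-- The lemma of Section 5.2.2: for a Hankel matrix `Z` with entries
`Z i j = z (i + j)` and `z 0 = 1`, `Z` has rank 1 with nonnegative entries
iff `z n = (z 1)^n` (with `z 1 ≥ 0`) for all `n ≤ 2K`. -/
theorem rank_one_hankel_iff_powers
    (K : ℕ) (hK : 1 ≤ K) (z : ℕ → ℝ) (hz0 : z 0 = 1) :
    ((Matrix.of fun i j : Fin (K + 1) => z ((i : ℕ) + (j : ℕ))).rank = 1 ∧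
        ∀ n : ℕ, n ≤ 2 * K → 0 ≤ z n) ↔
      (0 ≤ z 1 ∧ ∀ n : ℕ, n ≤ 2 * K → z n = (z 1) ^ n) := by
  constructor
  · rintro ⟨hr, hnn⟩
    refine ⟨hnn 1 (by lia), ?_⟩
    have hmul (i j : ℕ) (hi : i ≤ K) (hj : j ≤ K) : z (i + j) = z i * z j := by
      have h := Matrix.mul_apply_comm_of_rank_le_one hr.le
        (⟨i, by lia⟩ : Fin (K + 1)) 0 ⟨j, by lia⟩ 0
      simpa [hz0] using h
    have hpow (n : ℕ) (hn : n ≤ K) : z n = z 1 ^ n := by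
      induction n with
      | zero => simpa using hz0
      | succ n ih => rw [hmul n 1 (by lia) hK, ih (by lia), pow_succ]
    intro n hn
    obtain ⟨i, j, hi, hj, rfl⟩ : ∃ i j, i ≤ K ∧ j ≤ K ∧ n = i + j :=
      ⟨min n K, n - min n K, by lia, by lia, by lia⟩
    rw [hmul i j hi hj, hpow i hi, hpow j hj, pow_add]
  · rintro ⟨h1, hp⟩
    refine ⟨?_, fun n hn => hp n hn ▸ pow_nonneg h1 n⟩
    have hZ : (Matrix.of fun i j : Fin (K + 1) => z ((i : ℕ) + (j : ℕ))) =
        Matrix.vecMulVec (fun i : Fin (K + 1) => z 1 ^ (i : ℕ))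
          (fun j : Fin (K + 1) => z 1 ^ (j : ℕ)) := by
      ext i j
      rw [Matrix.of_apply, Matrix.vecMulVec_apply, hp _ (by lia), pow_add]
    rw [hZ]
    exact Matrix.rank_vecMulVec_eq_one (i := 0) (j := 0) (by simp) (by simp)
end

section
/- Let n be a finite type and let P be an n × n real doubly stochastic matrix. Then ∑_{i, j} (P i j)^2 = card n if and only if there exists a permutation σ of n such that P is the permutation matrix of σ (P i j = 1 if σ i = j and P i j = 0 otherwise). (The equality case of the claim in Section 5.2.1 of the paper that the Frobenius norm over the set of doubly stochastic matrices is maximized exactly by permutation matrices.) -/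
/-- A nonnegative vector with sum `1` having some entry equal to `1` is an indicator vector. -/
theorem eq_ite_of_sum_eq_one_of_apply_eq_one {n : Type*} [Fintype n] [DecidableEq n]
    {v : n → ℝ} (hv : ∀ j, 0 ≤ v j) (hsum : ∑ j, v j = 1) {k : n} (hk : v k = 1) (j : n) :
    v j = if k = j then 1 else 0 := by
  split_ifs with h
  · rw [← h, hk]
  · have hrest : ∑ i ∈ Finset.univ.erase k, v i = 0 := by
      have := Finset.add_sum_erase Finset.univ v (Finset.mem_univ k)
      linarith
    exact (Finset.sum_eq_zero_iff_of_nonneg fun i _ => hv i).1 hrest j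
      (Finset.mem_erase.2 ⟨Ne.symm h, Finset.mem_univ j⟩)

/-- If the squared entries of a row-stochastic matrix sum to the number of rows, then every entry
is `0` or `1`. -/
theorem eq_zero_or_one_of_sum_sq_eq_card {m n : Type*} [Fintype m] [Fintype n]
    {P : Matrix m n ℝ} (hnonneg : ∀ i j, 0 ≤ P i j) (hrow : ∀ i, ∑ j, P i j = 1)
    (hsq : ∑ i, ∑ j, (P i j) ^ 2 = (Fintype.card m : ℝ)) (i : m) (j : n) :
    P i j = 0 ∨ P i j = 1 := by
  have hle : ∀ i j, P i j ≤ 1 := fun i j =>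
    (Finset.single_le_sum (fun k _ => hnonneg i k) (Finset.mem_univ j)).trans_eq (hrow i)
  have hdefect : ∀ i j, 0 ≤ P i j - P i j ^ 2 := fun i j => by
    nlinarith [hnonneg i j, hle i j]
  have hzero : ∑ i, ∑ j, (P i j - P i j ^ 2) = 0 := by
    simp [Finset.sum_sub_distrib, hrow, hsq]
  have hi := (Finset.sum_eq_zero_iff_of_nonneg
    fun i _ => Finset.sum_nonneg fun j _ => hdefect i j).1 hzero i (Finset.mem_univ i)
  have hij := (Finset.sum_eq_zero_iff_of_nonneg fun j _ => hdefect i j).1 hi j (Finset.mem_univ j)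
  have hmul : P i j * (1 - P i j) = 0 := by linarith
  exact (mul_eq_zero.1 hmul).imp_right fun h => (sub_eq_zero.1 h).symm

/-- Section 5.2.1 (equality case of the Frobenius-norm claim): a doubly
stochastic matrix attains squared Frobenius norm `card n` iff it is a
permutation matrix. -/
theorem doublyStochastic_sq_frobenius_eq_card_iff_perm
    (n : Type*) [Fintype n] [DecidableEq n]
    (P : Matrix n n ℝ)
    (hnonneg : ∀ i j, 0 ≤ P i j)
    (hrow : ∀ i, ∑ j, P i j = 1)
    (hcol : ∀ j, ∑ i, P i j = 1) :
    ∑ i, ∑ j, (P i j) ^ 2 = (Fintype.card n : ℝ) ↔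
      ∃ σ : Equiv.Perm n, ∀ i j, P i j = if σ i = j then 1 else 0 := by
  constructor
  · intro hsq
    have h01 := eq_zero_or_one_of_sum_sq_eq_card hnonneg hrow hsq
    have hone : ∀ i, ∃ j, P i j = 1 := fun i => by
      obtain ⟨j, -, hj⟩ := Finset.exists_ne_zero_of_sum_ne_zero
        ((hrow i).trans_ne one_ne_zero)
      exact ⟨j, (h01 i j).resolve_left hj⟩
    choose f hf using hone
    have hP : ∀ i j, P i j = if f i = j then 1 else 0 := fun i =>
      eq_ite_of_sum_eq_one_of_apply_eq_one (hnonneg i) (hrow i) (hf i)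
    have hsurj : Function.Surjective f := fun j => by
      obtain ⟨i, -, hi⟩ := Finset.exists_ne_zero_of_sum_ne_zero
        ((hcol j).trans_ne one_ne_zero)
      rw [hP] at hi
      exact ⟨i, by_contra fun h => hi (if_neg h)⟩
    exact ⟨Equiv.ofBijective f (Finite.surjective_iff_bijective.1 hsurj), hP⟩
  · rintro ⟨σ, hσ⟩
    simp [hσ]
end

section
/- Let N ≥ 1 and K ≥ 1, let z : Fin N → ℕ → ℝ satisfy z i 0 = 1 for every i, and suppose that for each i the (K+1) × (K+1) Hankel matrix with entries z i (a + b) (a, b ∈ Fin (K+1)) has rank 1 and that z i n ≥ 0 for all n ≤ 2K. Let α : Fin N → ℕ → ℝ be given coefficients and suppose the linear equations ∑_{i} α i k · z i k = 0 hold for every k ≤ 2K. Then, setting T i = z i 1, the polynomial equations ∑_{i} α i k · (T i)^k = 0 hold for every k ≤ 2K. (The claim in Section 5.2.2 of the paper that every solution of the rank-one Hankel feasibility problem (16) is a solution of the original polynomial system (8).) -/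
/-- The `2 × 2` minors of a matrix of rank at most one vanish. -/
theorem Matrix.mul_apply_eq_of_rank_le_one {m n F : Type*} [Finite m] [Fintype n] [Field F]
    {A : Matrix m n F} (hA : A.rank ≤ 1) (i k : m) (j l : n) :
    A i j * A k l = A i l * A k j := by
  rw [Matrix.rank_eq_finrank_span_cols, finrank_le_one_iff] at hA
  obtain ⟨v, hv⟩ := hA
  have hcol : ∀ j, ∃ c : F, ∀ i, A i j = c * (v : m → F) i := fun j ↦ by
    obtain ⟨c, hc⟩ := hv ⟨A.col j, Submodule.subset_span ⟨j, rfl⟩⟩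
    exact ⟨c, fun i ↦ (congrFun (congrArg Subtype.val hc) i).symm⟩
  obtain ⟨c, hc⟩ := hcol j
  obtain ⟨d, hd⟩ := hcol l
  rw [hc, hc, hd, hd]
  ring

/-- A sequence starting at `1` whose Hankel matrix has rank at most one is geometric over the range
of indices seen by that matrix. -/
theorem eq_pow_of_rank_hankel_le_one {F : Type*} [Field F] {K : ℕ} (hK : 1 ≤ K) {z : ℕ → F}
    (hz0 : z 0 = 1)
    (hrank : (Matrix.of fun a b : Fin (K + 1) => z ((a : ℕ) + (b : ℕ))).rank ≤ 1)
    {k : ℕ} (hk : k ≤ 2 * K) : z k = z 1 ^ k := by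
  have hmul : ∀ a b, a ≤ K → b ≤ K → z (a + b) = z a * z b := fun a b ha hb ↦ by
    simpa [hz0] using Matrix.mul_apply_eq_of_rank_le_one hrank
      ⟨a, by omega⟩ ⟨0, by omega⟩ ⟨b, by omega⟩ ⟨0, by omega⟩
  have hpow : ∀ a, a ≤ K → z a = z 1 ^ a := fun a ↦ by
    induction a with
    | zero => simp [hz0]
    | succ a ih => exact fun ha ↦ by rw [hmul a 1 (by omega) hK, ih (by omega), pow_succ]
  obtain ⟨a, b, ha, hb, rfl⟩ : ∃ a b, a ≤ K ∧ b ≤ K ∧ k = a + b :=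
    ⟨min k K, k - min k K, by omega, by omega, by omega⟩
  rw [hmul a b ha hb, hpow a ha, hpow b hb, pow_add]

/-- Section 5.2.2: every solution of the rank-one Hankel feasibility problem (16)
is a solution of the original polynomial system (8): if each Hankel matrix built
from `z i` has rank one with nonnegative entries and `z i 0 = 1`, then the linear
equations on the `z i k` imply the polynomial equations on `T i = z i 1`. -/
theorem rank_one_hankel_solution_solves_polynomial_system
    (N : ℕ) (hN : 1 ≤ N) (K : ℕ) (hK : 1 ≤ K)
    (z : Fin N → ℕ → ℝ) (hz0 : ∀ i, z i 0 = 1)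
    (hrank : ∀ i : Fin N,
      (Matrix.of fun a b : Fin (K + 1) => z i ((a : ℕ) + (b : ℕ))).rank = 1)
    (hnonneg : ∀ i : Fin N, ∀ n : ℕ, n ≤ 2 * K → 0 ≤ z i n)
    (α : Fin N → ℕ → ℝ)
    (hlin : ∀ k : ℕ, k ≤ 2 * K → ∑ i : Fin N, α i k * z i k = 0) :
    ∀ k : ℕ, k ≤ 2 * K → ∑ i : Fin N, α i k * (z i 1) ^ k = 0 := by
  intro k hk
  rw [← hlin k hk]
  exact Finset.sum_congr rfl fun i _ ↦ by
    rw [eq_pow_of_rank_hankel_le_one hK (hz0 i) (hrank i).le hk]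
end
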